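/- Fix a ∈ ℝ with −1 < a < 1. The generalized harmonic Koebe mapping k_a(z) = h_a(z) + conj(g_a(z)), with h_a(z) = (z + ((a−1)/2)z² + ((1+a)/6)z³)/(1−z)³ and g_a(z) = (a·z + ((1−a)/2)z² + ((1+a)/6)z³)/(1−z)³, is injective on the unit disk 𝔻 = {z ∈ ℂ : |z| < 1}. -/

import Mathlib

open Complex Metric

/-- A point `w` of the right half-plane is determined by `Re (w ^ 3)` and `Im (w ^ 2)`. -/
theorem eq_of_re_cube_eq_of_im_sq_eq {w₁ w₂ : ℂ} (h₁ : 0 < w₁.re) (h₂ : 0 < w₂.re)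
    (hre : (w₁ ^ 3).re = (w₂ ^ 3).re) (him : (w₁ ^ 2).im = (w₂ ^ 2).im) : w₁ = w₂ := by
  obtain ⟨x, y⟩ := w₁
  obtain ⟨u, v⟩ := w₂
  simp only [pow_succ, pow_zero, one_mul, mul_re, mul_im] at h₁ h₂ hre him
  have hxy : x * y = u * v := by linarith
  have hne : 3 * (x * y) ^ 2 + x * u * (x ^ 2 + x * u + u ^ 2) ≠ 0 := by positivity
  have hmul : (x - u) * (3 * (x * y) ^ 2 + x * u * (x ^ 2 + x * u + u ^ 2)) = 0 := by
    linear_combination x * u * hre + 3 * x * (x * y + u * v) * hxy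
  have hxu : x = u := by
    rcases mul_eq_zero.mp hmul with h | h
    · linarith
    · exact absurd h hne
  subst hxu
  rw [mul_left_cancel₀ h₁.ne' hxy]

theorem one_sub_ne_zero_of_mem_unitBall {z : ℂ} (hz : z ∈ ball (0 : ℂ) 1) : 1 - z ≠ 0 := by
  rintro h
  rw [← sub_eq_zero.mp h] at hz
  simp at hz

/-- The Cayley transform `z ↦ (1 + z) / (1 - z)` maps the unit disk into the right half-plane. -/
theorem re_one_add_div_one_sub_pos {z : ℂ} (hz : z ∈ ball (0 : ℂ) 1) :
    0 < ((1 + z) / (1 - z)).re := by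
  have hn : 0 < normSq (1 - z) := normSq_pos.mpr (one_sub_ne_zero_of_mem_unitBall hz)
  have hz' : normSq z < 1 := by
    rw [normSq_eq_norm_sq]
    have := mem_ball_zero_iff.mp hz
    nlinarith [norm_nonneg z]
  rw [normSq_apply] at hz'
  rw [div_re, ← add_div]
  refine div_pos ?_ hn
  simp only [add_re, add_im, sub_re, sub_im, one_re, one_im]
  linarith

/-- The generalized harmonic Koebe mapping `k_a = h_a + conj(g_a)` is injective
on the unit disk. -/
theorem generalizedHarmonicKoebe_injective (a : ℝ) (ha₁ : -1 < a) (ha₂ : a < 1)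
    (h_a g_a : ℂ → ℂ)
    (hh : h_a = fun z => (z + (((a : ℂ) - 1) / 2) * z ^ 2 + ((1 + (a : ℂ)) / 6) * z ^ 3) / (1 - z) ^ 3)
    (hg : g_a = fun z => ((a : ℂ) * z + ((1 - (a : ℂ)) / 2) * z ^ 2 + ((1 + (a : ℂ)) / 6) * z ^ 3) / (1 - z) ^ 3) :
    Set.InjOn (fun z => h_a z + (starRingEnd ℂ) (g_a z)) (ball (0 : ℂ) 1) := by
  have hadd : ∀ z ∈ ball (0 : ℂ) 1,
      h_a z + g_a z = ((1 + a) / 6 : ℝ) * (((1 + z) / (1 - z)) ^ 3 - 1) := by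
    intro z hz
    have := one_sub_ne_zero_of_mem_unitBall hz
    rw [hh, hg]
    push_cast
    field_simp
    ring
  have hsub : ∀ z ∈ ball (0 : ℂ) 1,
      h_a z - g_a z = ((1 - a) / 4 : ℝ) * (((1 + z) / (1 - z)) ^ 2 - 1) := by
    intro z hz
    have := one_sub_ne_zero_of_mem_unitBall hz
    rw [hh, hg]
    push_cast
    field_simp
    ring
  intro z₁ hz₁ z₂ hz₂ heq
  have hre : (h_a z₁ + g_a z₁).re = (h_a z₂ + g_a z₂).re := by
    simpa using congrArg re heq
  have him : (h_a z₁ - g_a z₁).im = (h_a z₂ - g_a z₂).im := by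
    simpa [sub_eq_add_neg] using congrArg im heq
  rw [hadd z₁ hz₁, hadd z₂ hz₂, re_ofReal_mul, re_ofReal_mul, sub_re, sub_re] at hre
  rw [hsub z₁ hz₁, hsub z₂ hz₂, im_ofReal_mul, im_ofReal_mul, sub_im, sub_im] at him
  have hw := eq_of_re_cube_eq_of_im_sq_eq (re_one_add_div_one_sub_pos hz₁)
    (re_one_add_div_one_sub_pos hz₂)
    (sub_left_injective (mul_left_cancel₀ (by linarith) hre))
    (sub_left_injective (mul_left_cancel₀ (by linarith) him))
  rw [div_eq_div_iff (one_sub_ne_zero_of_mem_unitBall hz₁)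
    (one_sub_ne_zero_of_mem_unitBall hz₂)] at hw
  linear_combination hw / 2
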